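/- Let ℙ be a stationary, ergodic process over a finite alphabet 𝒳, let E_β be a predictive equivalence class of regular pasts, and let w ∈ 𝒳* be a word. Then the set E_{β,w} = { x ∈ 𝒳^ℤ : the past part x⃖ of x lies in E_β and x_0…x_{|w|-1} = w } is measurable, and ℙ(E_{β,w}) = ℙ^-(E_β) · 𝐏(w|E_β). -/

import Mathlib

open MeasureTheory Filter Topology
open scoped Classical

namespace EM

variable {X : Type*} [Fintype X] [MeasurableSpace X] [MeasurableSingletonClass X]

/-- The left shift on bi-infinite sequences. -/
def shift (ω : ℤ → X) : ℤ → X := fun n => ω (n + 1)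

/-- ℙ(w): probability of the cylinder set of the word `w` at position 0. -/
noncomputable def wordProb (μ : Measure (ℤ → X)) (w : List X) : ℝ :=
  (μ {ω | ∀ k : Fin w.length, ω ((k : ℕ) : ℤ) = w.get k}).toReal

/-- Stationarity: invariance of the measure under the shift. -/
def Stationary (μ : Measure (ℤ → X)) : Prop := Measure.map shift μ = μ

/-- Ergodicity: every shift-invariant measurable event is trivial. -/
def Ergodic' (μ : Measure (ℤ → X)) : Prop :=
  ∀ A : Set (ℤ → X), MeasurableSet A → shift ⁻¹' A = A → μ A = 0 ∨ μ A = 1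

/-- Projection of a bi-infinite sequence to its past:  (pastMap ω) n = x_{-(n+1)}. -/
def pastMap (ω : ℤ → X) : ℕ → X := fun n => ω (-((n : ℤ) + 1))

/-- ℙ⁻ : the marginal of ℙ on past sequences. -/
noncomputable def pastMeasure (μ : Measure (ℤ → X)) : Measure (ℕ → X) :=
  Measure.map pastMap μ

/-- x⃖^t = x_{-t} … x_{-1}, the last `t` symbols of the past `p`, as a word. -/
def pastWord (p : ℕ → X) (t : ℕ) : List X := (List.range t).reverse.map p

/-- A past is nontrivial if all of its finite suffixes have positive probability. -/
def Nontrivial' (μ : Measure (ℤ → X)) (p : ℕ → X) : Prop :=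
  ∀ t : ℕ, 0 < wordProb μ (pastWord p t)

/-- ℙ(w | v) = ℙ(vw)/ℙ(v): conditional probability that `w` follows `v`. -/
noncomputable def condProb (μ : Measure (ℤ → X)) (w v : List X) : ℝ :=
  wordProb μ (v ++ w) / wordProb μ v

/-- A past is `w`-regular if it is nontrivial and lim_{t→∞} ℙ(w|x⃖^t) exists. -/
def WRegular (μ : Measure (ℤ → X)) (p : ℕ → X) (w : List X) : Prop :=
  Nontrivial' μ p ∧ ∃ L : ℝ, Tendsto (fun t => condProb μ w (pastWord p t)) atTop (𝓝 L)

/-- A past is regular if it is nontrivial and `w`-regular for every nonempty word `w`. -/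
def Regular (μ : Measure (ℤ → X)) (p : ℕ → X) : Prop :=
  Nontrivial' μ p ∧ ∀ w : List X, w ≠ [] →
    ∃ L : ℝ, Tendsto (fun t => condProb μ w (pastWord p t)) atTop (𝓝 L)

/-- 𝐏(w|x⃖) = lim_{t→∞} ℙ(w|x⃖^t)  (meaningful for regular pasts). -/
noncomputable def predProb (μ : Measure (ℤ → X)) (p : ℕ → X) (w : List X) : ℝ :=
  limUnder atTop (fun t => condProb μ w (pastWord p t))

/-- The past x⃖x obtained by appending the symbol `x` to the past x⃖. -/
def extendPast (p : ℕ → X) (x : X) : ℕ → X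
  | 0 => x
  | n + 1 => p n

/-- The past obtained by appending a word symbol by symbol. -/
def extendWord (p : ℕ → X) : List X → (ℕ → X)
  | [] => p
  | x :: u => extendWord (extendPast p x) u

/-- The predictive equivalence class of the (regular) past `p`. -/
def classOf (μ : Measure (ℤ → X)) (p : ℕ → X) : Set (ℕ → X) :=
  {q | Regular μ q ∧ ∀ w : List X, w ≠ [] → predProb μ q w = predProb μ p w}

section HMM

variable {S : Type*} [Fintype S] [DecidableEq S]

/-- T^(w) = T^(w₀) ⋯ T^(w_{l-1}). -/
def wordMatrix (T : X → Matrix S S ℝ) (w : List X) : Matrix S S ℝ :=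
  (w.map T).prod

/-- 𝐏_{σ_i}(w) = ‖e_i T^(w)‖₁, the probability of emitting `w` from state `i`. -/
noncomputable def stateWordProb (T : X → Matrix S S ℝ) (i : S) (w : List X) : ℝ :=
  ∑ j, wordMatrix T w i j

/-- All transition matrices have nonnegative entries. -/
def HMMNonneg (T : X → Matrix S S ℝ) : Prop := ∀ x i j, 0 ≤ T x i j

/-- The overall transition matrix T = Σ_x T^(x) is row-stochastic. -/
def HMMStochastic (T : X → Matrix S S ℝ) : Prop := ∀ i, ∑ x : X, ∑ j, T x i j = 1

/-- The overall state-to-state transition matrix T = Σ_x T^(x). -/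
noncomputable def totalT (T : X → Matrix S S ℝ) : Matrix S S ℝ := ∑ x : X, T x

/-- Irreducibility: the directed graph with an edge i → j whenever T_{ij} > 0 is
strongly connected. -/
def Irreducible' (T : X → Matrix S S ℝ) : Prop :=
  ∀ i j : S, ∃ n : ℕ, 0 < n ∧ 0 < (totalT T ^ n) i j

/-- Unifilarity: from each state, each symbol leads to at most one state. -/
def Unifilar (T : X → Matrix S S ℝ) : Prop :=
  ∀ (x : X) (i j k : S), 0 < T x i j → 0 < T x i k → j = k

/-- Probabilistically distinct states. -/
def ProbDistinct (T : X → Matrix S S ℝ) : Prop :=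
  ∀ i j : S, i ≠ j → ∃ w : List X, w ≠ [] ∧ stateWordProb T i w ≠ stateWordProb T j w

/-- π is a stationary distribution for the HMM: π ≥ 0, Σπ = 1, π = πT. -/
def IsStationaryDist (T : X → Matrix S S ℝ) (π : S → ℝ) : Prop :=
  (∀ i, 0 ≤ π i) ∧ (∑ i, π i = 1) ∧ (∀ j, ∑ i, π i * totalT T i j = π j)

/-- A generator ε-machine: a valid, irreducible, unifilar HMM with
probabilistically distinct states. -/
def IsGenEM (T : X → Matrix S S ℝ) : Prop :=
  HMMNonneg T ∧ HMMStochastic T ∧ Irreducible' T ∧ Unifilar T ∧ ProbDistinct T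

/-- The set of regular pasts whose predictions agree with state `i` of the HMM `T`. -/
def stateClass (μ : Measure (ℤ → X)) (T : X → Matrix S S ℝ) (i : S) : Set (ℕ → X) :=
  {q | Regular μ q ∧ ∀ w : List X, w ≠ [] → predProb μ q w = stateWordProb T i w}

end HMM

/-- The symbol-labeled transition matrices of the history ε-machine, given
representatives `p i` of the positive-probability predictive equivalence classes:
T^(x)_{ij} = 𝐏(x|E_i) if 𝐏(x|E_i) > 0 and δ_h(E_i,x) = E_j, and 0 otherwise. -/
noncomputable def histT (μ : Measure (ℤ → X)) {N : ℕ} (p : Fin N → (ℕ → X)) (x : X) :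
    Matrix (Fin N) (Fin N) ℝ := fun i j =>
  if 0 < predProb μ (p i) [x] ∧ classOf μ (extendPast (p i) x) = classOf μ (p j)
  then predProb μ (p i) [x] else 0

/-- ℙ is finitely characterized, with the pasts `p i` representing the finitely many
positive-probability predictive equivalence classes E_i = classOf μ (p i). -/
def FinitelyCharacterized (μ : Measure (ℤ → X)) {N : ℕ} (p : Fin N → (ℕ → X)) : Prop :=
  (∀ i, Regular μ (p i)) ∧
  (∀ i j : Fin N, i ≠ j → classOf μ (p i) ≠ classOf μ (p j)) ∧
  (∀ i, 0 < pastMeasure μ (classOf μ (p i))) ∧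
  (∑ i, pastMeasure μ (classOf μ (p i)) = 1)

end EM

namespace EM

section CylinderProb

variable {X : Type*}

/-- The cylinder set of sequences showing the word `w` at positions `0, …, |w| - 1`. -/
def wordCylinder (w : List X) : Set (ℤ → X) :=
  {ω | ∀ k : Fin w.length, ω ((k : ℕ) : ℤ) = w.get k}

/-- The last `t` symbols of the past of a bi-infinite sequence. -/
def pastPrefix (t : ℕ) (ω : ℤ → X) : Fin t → X := fun i => pastMap ω i

theorem pastWord_length (p : ℕ → X) (t : ℕ) : (pastWord p t).length = t := by
  simp [pastWord]

theorem pastWord_eq_ofFn (p : ℕ → X) (t : ℕ) :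
    pastWord p t = (List.ofFn fun i : Fin t => p i).reverse := by
  rw [pastWord, List.map_reverse, List.ofFn_eq_map, ← List.map_coe_finRange_eq_range,
    List.map_map]
  rfl

theorem shift_iterate_apply (t : ℕ) (ω : ℤ → X) (n : ℤ) : shift^[t] ω n = ω (n + t) := by
  induction t generalizing ω with
  | zero => simp
  | succ t ih =>
    rw [Function.iterate_succ_apply, ih, shift]
    congr 1
    push_cast
    ring

theorem wordCylinder_append (v w : List X) :
    wordCylinder (v ++ w) = {ω | (∀ k : Fin v.length, ω ((k : ℕ) : ℤ) = v.get k) ∧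
      ∀ k : Fin w.length, ω (((k : ℕ) : ℤ) + v.length) = w.get k} := by
  ext ω
  simp only [wordCylinder, Set.mem_ofPred_eq, Fin.forall_iff, List.get_eq_getElem]
  constructor
  · intro h
    refine ⟨fun i hi => ?_, fun i hi => ?_⟩
    · rw [h i (by simp; omega), List.getElem_append_left hi]
    · have := h (i + v.length) (by simp; omega)
      rw [List.getElem_append_right (by omega)] at this
      simpa using this
  · rintro ⟨h₁, h₂⟩ i hi
    by_cases hiv : i < v.length
    · rw [h₁ i hiv, List.getElem_append_left hiv]
    · have := h₂ (i - v.length) (by simp at hi; omega)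
      rw [List.getElem_append_right (by omega), ← this]
      congr 1
      omega

theorem shift_iterate_preimage_pastPrefix (ω₀ : ℤ → X) (t : ℕ) (w : List X) :
    shift^[t] ⁻¹' (pastPrefix t ⁻¹' {pastPrefix t ω₀} ∩ wordCylinder w)
      = wordCylinder (pastWord (pastMap ω₀) t ++ w) := by
  rw [wordCylinder_append]
  ext ω
  simp only [Set.mem_preimage, Set.mem_inter_iff, Set.mem_singleton_iff, funext_iff, pastPrefix,
    wordCylinder, Set.mem_ofPred_eq, pastWord_length, shift_iterate_apply, Fin.forall_iff]
  refine and_congr_left fun _ => ?_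
  have hget : ∀ i (hi : i < (pastWord (pastMap ω₀) t).length),
      (pastWord (pastMap ω₀) t).get ⟨i, hi⟩ = pastMap ω₀ (t - 1 - i) := by
    intro i hi
    simp [pastWord]
  simp only [hget]
  simp only [pastMap, shift_iterate_apply]
  constructor
  · intro h i hi
    rw [← h (t - 1 - i) (by omega)]
    congr 1
    omega
  · intro h i hi
    have := h (t - 1 - i) (by omega)
    rw [show t - 1 - (t - 1 - i) = i by omega] at this
    rw [← this]
    congr 1
    omega

theorem pastWord_pastMap_congr {ω ω' : ℤ → X} {t : ℕ} (h : pastPrefix t ω = pastPrefix t ω') :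
    pastWord (pastMap ω) t = pastWord (pastMap ω') t := by
  rw [pastWord_eq_ofFn, pastWord_eq_ofFn]
  exact congrArg (fun v => (List.ofFn v).reverse) h

variable [MeasurableSpace X]

theorem measurable_pastMap : Measurable (pastMap : (ℤ → X) → ℕ → X) :=
  measurable_pi_lambda _ fun _ => measurable_pi_apply _

theorem measurable_pastPrefix (t : ℕ) : Measurable (pastPrefix t : (ℤ → X) → Fin t → X) :=
  measurable_pi_lambda _ fun _ => measurable_pi_apply _

theorem measurable_shift : Measurable (shift : (ℤ → X) → ℤ → X) :=
  measurable_pi_lambda _ fun _ => measurable_pi_apply _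

/-- The filtration generated by longer and longer finite pasts. -/
def pastFiltration : Filtration ℕ (inferInstance : MeasurableSpace (ℤ → X)) where
  seq t := MeasurableSpace.comap (pastPrefix t) inferInstance
  mono' s t hst := by
    refine Measurable.comap_le (m₁ := MeasurableSpace.comap (pastPrefix t) inferInstance) ?_
    have hres : Measurable fun (v : Fin t → X) (i : Fin s) => v (Fin.castLE hst i) :=
      measurable_pi_lambda _ fun _ => measurable_pi_apply _
    exact hres.comp (comap_measurable (pastPrefix t))
  le' t := (measurable_pastPrefix t).comap_le

theorem measurable_pastMap_iSup :
    Measurable[⨆ t, pastFiltration (X := X) t] (pastMap : (ℤ → X) → ℕ → X) := by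
  refine @measurable_pi_lambda _ _ _ (⨆ t, pastFiltration (X := X) t) _ _ fun n => ?_
  have h : Measurable[pastFiltration (X := X) (n + 1)] fun ω : ℤ → X => pastMap ω n :=
    (measurable_pi_apply (Fin.last n)).comp (comap_measurable (pastPrefix (n + 1)))
  exact h.mono (le_iSup (fun t => pastFiltration (X := X) t) (n + 1)) le_rfl

theorem mem_classOf_iff {μ : Measure (ℤ → X)} {p q : ℕ → X} :
    q ∈ classOf μ p ↔ Nontrivial' μ q ∧ ∀ w : List X, w ≠ [] →
      Tendsto (fun t => condProb μ w (pastWord q t)) atTop (𝓝 (predProb μ p w)) := by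
  constructor
  · rintro ⟨⟨hq, hlim⟩, heq⟩
    refine ⟨hq, fun w hw => ?_⟩
    rw [← heq w hw]
    exact tendsto_nhds_limUnder (hlim w hw)
  · rintro ⟨hq, hlim⟩
    exact ⟨⟨hq, fun w hw => ⟨_, hlim w hw⟩⟩, fun w hw => (hlim w hw).limUnder_eq⟩

variable [MeasurableSingletonClass X]

theorem measurableSet_wordCylinder (w : List X) : MeasurableSet (wordCylinder w) := by
  simp only [wordCylinder, Set.ofPred_forall]
  exact MeasurableSet.iInter fun k => measurable_pi_apply _ (measurableSet_singleton _)

variable [Fintype X]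

theorem measurable_comp_pastWord (g : List X → ℝ) (t : ℕ) :
    Measurable fun q : ℕ → X => g (pastWord q t) := by
  simp only [pastWord_eq_ofFn]
  have hres : Measurable fun (q : ℕ → X) (i : Fin t) => q i :=
    measurable_pi_lambda _ fun _ => measurable_pi_apply _
  exact (measurable_of_finite fun v : Fin t → X => g (List.ofFn v).reverse).comp hres

theorem measurableSet_classOf (μ : Measure (ℤ → X)) (p : ℕ → X) :
    MeasurableSet (classOf μ p) := by
  have heq : classOf μ p = {q | Nontrivial' μ q ∧ ∀ w : List X, w ≠ [] →
      Tendsto (fun t => condProb μ w (pastWord q t)) atTop (𝓝 (predProb μ p w))} :=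
    Set.ext fun q => mem_classOf_iff
  rw [heq]
  simp only [Nontrivial', Set.ofPred_and, Set.ofPred_forall]
  refine (MeasurableSet.iInter fun t => ?_).inter
    (MeasurableSet.iInter fun w => MeasurableSet.iInter fun _ => ?_)
  · exact measurableSet_lt measurable_const (measurable_comp_pastWord (wordProb μ) t)
  · exact measurableSet_tendsto _ fun t => measurable_comp_pastWord (condProb μ w) t

theorem measureReal_pastPrefix_inter {μ : Measure (ℤ → X)} (hstat : Stationary μ)
    (ω₀ : ℤ → X) (t : ℕ) (w : List X) :
    μ.real (pastPrefix t ⁻¹' {pastPrefix t ω₀} ∩ wordCylinder w)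
      = wordProb μ (pastWord (pastMap ω₀) t ++ w) := by
  have hpres : MeasurePreserving shift μ μ := ⟨measurable_shift, hstat⟩
  have hmeas : MeasurableSet (pastPrefix t ⁻¹' {pastPrefix t ω₀} ∩ wordCylinder w) :=
    (measurable_pastPrefix t (measurableSet_singleton _)).inter (measurableSet_wordCylinder w)
  rw [Measure.real, ← (hpres.iterate t).measure_preimage hmeas.nullMeasurableSet,
    shift_iterate_preimage_pastPrefix]
  rfl

theorem measureReal_pastPrefix {μ : Measure (ℤ → X)} (hstat : Stationary μ)
    (ω₀ : ℤ → X) (t : ℕ) :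
    μ.real (pastPrefix t ⁻¹' {pastPrefix t ω₀}) = wordProb μ (pastWord (pastMap ω₀) t) := by
  have hnil : wordCylinder ([] : List X) = Set.univ :=
    Set.eq_univ_of_forall fun _ k => k.elim0
  simpa [hnil] using measureReal_pastPrefix_inter hstat ω₀ t []

theorem integrable_condProb_pastWord (μ : Measure (ℤ → X)) [IsFiniteMeasure μ] (w : List X)
    (t : ℕ) : Integrable (fun ω => condProb μ w (pastWord (pastMap ω) t)) μ := by
  simp only [pastWord_eq_ofFn]
  exact (Integrable.of_finite (μ := μ.map (pastPrefix t))
    (f := fun v : Fin t → X => condProb μ w (List.ofFn v).reverse)).comp_measurable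
      (measurable_pastPrefix t)

theorem setIntegral_condProb_pastPrefix {μ : Measure (ℤ → X)} [IsFiniteMeasure μ]
    (hstat : Stationary μ) (w : List X) (t : ℕ) (v : Fin t → X) :
    ∫ ω in pastPrefix t ⁻¹' {v}, condProb μ w (pastWord (pastMap ω) t) ∂μ
      = μ.real (pastPrefix t ⁻¹' {v} ∩ wordCylinder w) := by
  rcases (pastPrefix t ⁻¹' {v}).eq_empty_or_nonempty with hempty | ⟨ω₀, hω₀⟩
  · simp [hempty]
  obtain rfl : pastPrefix t ω₀ = v := hω₀
  have hconst : ∫ ω in pastPrefix t ⁻¹' {pastPrefix t ω₀},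
      condProb μ w (pastWord (pastMap ω) t) ∂μ
      = ∫ _ in pastPrefix t ⁻¹' {pastPrefix t ω₀},
        condProb μ w (pastWord (pastMap ω₀) t) ∂μ :=
    setIntegral_congr_fun (measurable_pastPrefix t (measurableSet_singleton _)) fun ω hω =>
      congrArg (condProb μ w) (pastWord_pastMap_congr hω)
  rw [hconst, setIntegral_const, smul_eq_mul, condProb, ← measureReal_pastPrefix hstat,
    ← measureReal_pastPrefix_inter hstat]
  refine mul_div_cancel_of_imp' fun hzero => ?_
  exact le_antisymm (hzero ▸ measureReal_mono Set.inter_subset_left) measureReal_nonneg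

theorem condProb_ae_eq_condExp {μ : Measure (ℤ → X)} [IsFiniteMeasure μ]
    (hstat : Stationary μ) (w : List X) (t : ℕ) :
    (fun ω => condProb μ w (pastWord (pastMap ω) t))
      =ᵐ[μ] μ[(wordCylinder w).indicator (fun _ => (1 : ℝ))|pastFiltration (X := X) t] := by
  have hcyl := measurableSet_wordCylinder w
  have hint := integrable_condProb_pastWord μ w t
  refine ae_eq_condExp_of_forall_setIntegral_eq (pastFiltration.le t)
    ((integrable_const 1).indicator hcyl) (fun _ _ _ => hint.integrableOn) ?_ ?_
  · rintro _ ⟨S, -, rfl⟩ -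
    have hS : pastPrefix t ⁻¹' S = ⋃ v ∈ S.toFinset, pastPrefix t ⁻¹' {v} := by
      ext ω
      simp
    have hfib : ∀ v ∈ S.toFinset, MeasurableSet (pastPrefix (X := X) t ⁻¹' {v}) :=
      fun v _ => measurable_pastPrefix t (measurableSet_singleton v)
    have hdisj : (S.toFinset : Set (Fin t → X)).Pairwise
        (Function.onFun Disjoint fun v => pastPrefix (X := X) t ⁻¹' {v}) :=
      fun u _ v _ huv => Disjoint.preimage _ (Set.disjoint_singleton.2 huv)
    rw [hS, integral_biUnion_finset _ hfib hdisj fun _ _ => hint.integrableOn,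
      integral_biUnion_finset _ hfib hdisj fun _ _ =>
        ((integrable_const 1).indicator hcyl).integrableOn]
    refine Finset.sum_congr rfl fun v _ => ?_
    rw [setIntegral_condProb_pastPrefix hstat, setIntegral_indicator hcyl, setIntegral_const,
      smul_eq_mul, mul_one]
  · simp only [pastWord_eq_ofFn]
    exact ((measurable_of_finite fun v : Fin t → X => condProb μ w (List.ofFn v).reverse).comp
      (comap_measurable (pastPrefix t))).stronglyMeasurable.aestronglyMeasurable

theorem tendsto_condProb_ae {μ : Measure (ℤ → X)} [IsFiniteMeasure μ]
    (hstat : Stationary μ) (w : List X) :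
    ∀ᵐ ω ∂μ, Tendsto (fun t => condProb μ w (pastWord (pastMap ω) t)) atTop
      (𝓝 ((μ[(wordCylinder w).indicator (fun _ => (1 : ℝ))|
        ⨆ t, pastFiltration (X := X) t]) ω)) := by
  filter_upwards [tendsto_ae_condExp (ℱ := pastFiltration (X := X)) (μ := μ)
      ((wordCylinder w).indicator fun _ => (1 : ℝ)),
    ae_all_iff.2 fun t => condProb_ae_eq_condExp hstat w t] with ω hlim heq
  exact hlim.congr fun t => (heq t).symm

end CylinderProb

/-- For a predictive equivalence class E_β (represented by the regular past p₀)
and a word w, the set E_{β,w} of bi-infinite sequences whose past lies in E_β and which show w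
at positions 0,…,|w|-1 is measurable with ℙ(E_{β,w}) = ℙ⁻(E_β)·𝐏(w|E_β). -/
theorem class_cylinder_prob
    {X : Type*} [Fintype X] [MeasurableSpace X] [MeasurableSingletonClass X]
    (μ : Measure (ℤ → X)) [IsProbabilityMeasure μ]
    (hstat : Stationary μ) (herg : Ergodic' μ)
    (p₀ : ℕ → X) (hp₀ : Regular μ p₀) (w : List X) (hw : w ≠ []) :
    MeasurableSet {ω : ℤ → X | pastMap ω ∈ classOf μ p₀ ∧
        ∀ k : Fin w.length, ω ((k : ℕ) : ℤ) = w.get k} ∧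
    (μ {ω : ℤ → X | pastMap ω ∈ classOf μ p₀ ∧
        ∀ k : Fin w.length, ω ((k : ℕ) : ℤ) = w.get k}).toReal
      = (pastMeasure μ (classOf μ p₀)).toReal * predProb μ p₀ w := by
  have hclass := measurableSet_classOf μ p₀
  have hcyl := measurableSet_wordCylinder w
  refine ⟨(measurable_pastMap hclass).inter hcyl, ?_⟩
  have hcond : ∫ ω in pastMap ⁻¹' classOf μ p₀,
      (μ[(wordCylinder w).indicator (fun _ => (1 : ℝ))|⨆ t, pastFiltration (X := X) t]) ω ∂μ
      = ∫ ω in pastMap ⁻¹' classOf μ p₀,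
        (wordCylinder w).indicator (fun _ => (1 : ℝ)) ω ∂μ :=
    setIntegral_condExp (iSup_le pastFiltration.le)
      ((integrable_const 1).indicator hcyl) (measurable_pastMap_iSup hclass)
  have hlim : ∫ ω in pastMap ⁻¹' classOf μ p₀,
      (μ[(wordCylinder w).indicator (fun _ => (1 : ℝ))|⨆ t, pastFiltration (X := X) t]) ω ∂μ
      = ∫ _ in pastMap ⁻¹' classOf μ p₀, predProb μ p₀ w ∂μ := by
    refine setIntegral_congr_ae (measurable_pastMap hclass) ?_
    filter_upwards [tendsto_condProb_ae hstat w] with ω hω hmem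
    exact tendsto_nhds_unique hω ((mem_classOf_iff.1 hmem).2 w hw)
  rw [hlim, setIntegral_const, setIntegral_indicator hcyl, setIntegral_const] at hcond
  simp only [smul_eq_mul, mul_one, Measure.real] at hcond
  rw [pastMeasure, Measure.map_apply measurable_pastMap hclass]
  exact hcond.symm

end EM
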